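/- arXiv:1808.03932 — 2 statements merged into one kernel-verified Lean document; each statement's English description precedes it below -/
import Mathlib

section
/- Let G be a finite simple graph with n vertices and k edges, and let w ≥ 2 be a natural number such that (1 − 1/(w−1))·n²/2 < k ≤ (1 − 1/w)·n²/2. Then β(G) ≥ (n/w)·(1 + √(1 − 2kw/(n²(w−1)))). -/
noncomputable section

/-- The number of cliques of size `k` in `G` (the empty set is the unique clique of size 0). -/
def cliqueCount {V : Type*} [Fintype V] (G : SimpleGraph V) (k : ℕ) : ℕ :=
  Nat.card {s : Finset V // G.IsNClique k s}

/-- The clique number `ω(G)` of `G`. -/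
def cliqueNum {V : Type*} [Fintype V] (G : SimpleGraph V) : ℕ :=
  sSup {k : ℕ | ∃ s : Finset V, G.IsNClique k s}

/-- The PC-polynomial `PC(G,x) = ∑_{k=0}^{ω(G)} (-1)^k c_k(G) x^{ω(G)-k}`. -/
def PCpoly {V : Type*} [Fintype V] (G : SimpleGraph V) : Polynomial ℝ :=
  ∑ k ∈ Finset.range (cliqueNum G + 1),
    Polynomial.C ((-1 : ℝ) ^ k * (cliqueCount G k : ℝ)) * Polynomial.X ^ (cliqueNum G - k)

/-- `β(G)`, the largest real root of the PC-polynomial of `G`. -/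
def beta {V : Type*} [Fintype V] (G : SimpleGraph V) : ℝ :=
  sSup {x : ℝ | (PCpoly G).eval x = 0}

open Finset Polynomial fwdDiff

open Classical in
/-- The finset of cliques of `G` contained in `U`. -/
def cliquesIn {V : Type*} (G : SimpleGraph V) (U : Finset V) : Finset (Finset V) :=
  {K ∈ U.powerset | G.IsClique (K : Set V)}

/-- The clique polynomial of the subgraph of `G` induced by `U`, with alternating signs:
the sum of `(-t) ^ #K` over the cliques `K ⊆ U`. -/
def cliqueSum {V : Type*} (G : SimpleGraph V) (U : Finset V) (t : ℝ) : ℝ :=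
  ∑ K ∈ cliquesIn G U, (-t) ^ #K

section Induced

variable {V : Type*} {G : SimpleGraph V}

lemma mem_cliquesIn {U K : Finset V} :
    K ∈ cliquesIn G U ↔ K ⊆ U ∧ G.IsClique (K : Set V) := by
  simp [cliquesIn]

lemma continuous_cliqueSum (G : SimpleGraph V) (U : Finset V) : Continuous (cliqueSum G U) := by
  unfold cliqueSum
  fun_prop

lemma cliqueSum_zero_right (G : SimpleGraph V) (U : Finset V) : cliqueSum G U 0 = 1 := by
  unfold cliqueSum
  rw [sum_eq_single ∅]
  · simp
  · intro K _ hK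
    simp [hK]
  · intro h
    simp [mem_cliquesIn] at h

open Classical in
lemma cliqueSum_insert {v : V} {W : Finset V} (hv : v ∉ W) (t : ℝ) :
    cliqueSum G (insert v W) t
      = cliqueSum G W t - t * cliqueSum G {u ∈ W | G.Adj v u} t := by
  have key : {K ∈ W.powerset | G.IsClique ((insert v K : Finset V) : Set V)}
      = cliquesIn G {u ∈ W | G.Adj v u} := by
    ext K
    simp only [mem_filter, mem_powerset, mem_cliquesIn]
    constructor
    · rintro ⟨hK, hc⟩
      have hvK : v ∉ K := fun h ↦ hv (hK h)
      rw [coe_insert, SimpleGraph.isClique_insert_of_notMem (by simpa using hvK)] at hc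
      exact ⟨fun u hu ↦ mem_filter.2 ⟨hK hu, hc.2 u hu⟩, hc.1⟩
    · rintro ⟨hK, hc⟩
      refine ⟨fun u hu ↦ (mem_filter.1 (hK hu)).1, ?_⟩
      rw [coe_insert, SimpleGraph.isClique_insert]
      exact ⟨hc, fun u hu _ ↦ (mem_filter.1 (hK hu)).2⟩
  unfold cliqueSum
  rw [← key, cliquesIn, cliquesIn, sum_filter, sum_powerset_insert hv, ← sum_filter, ← sum_filter,
    sub_eq_add_neg, ← neg_mul, mul_sum]
  congr 1
  refine sum_congr rfl fun K hK ↦ ?_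
  rw [card_insert_of_notMem fun h ↦ hv (mem_powerset.1 (mem_filter.1 hK).1 h), pow_succ, mul_comm]

lemma cliqueSum_pos_of_subset {U W : Finset V} (hWU : W ⊆ U) {t : ℝ}
    (hU : ∀ s ∈ Set.Icc 0 t, 0 < cliqueSum G U s) :
    ∀ s ∈ Set.Icc 0 t, 0 < cliqueSum G W s := by
  classical
  induction U using Finset.strongInduction generalizing W t with
  | H U ih =>
    rcases hWU.eq_or_ssubset with rfl | hss
    · exact hU
    obtain ⟨v, hvU, hvW⟩ := exists_of_ssubset hss
    have hlt : U.erase v ⊂ U := erase_ssubset hvU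
    refine ih _ hlt (subset_erase.2 ⟨hWU, hvW⟩) ?_
    by_contra! hneg
    obtain ⟨s, hs, hs0⟩ := hneg
    have hcpt : IsCompact (Set.Icc 0 t ∩ {r | cliqueSum G (U.erase v) r ≤ 0}) :=
      isCompact_Icc.inter_right
        (isClosed_le (continuous_cliqueSum G _) continuous_const)
    obtain ⟨r, ⟨⟨hr0, hrt⟩, hr⟩, hmin⟩ := hcpt.exists_isLeast ⟨s, hs, hs0⟩
    have hr : cliqueSum G (U.erase v) r ≤ 0 := hr
    have hrpos : 0 < r := by
      refine hr0.lt_of_ne ?_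
      rintro rfl
      rw [cliqueSum_zero_right] at hr
      linarith
    have hlink : ∀ x ∈ Set.Ico 0 r, 0 < cliqueSum G {u ∈ U.erase v | G.Adj v u} x := by
      intro x hx
      suffices hx' : ∀ y ∈ Set.Icc 0 x, 0 < cliqueSum G (U.erase v) y from
        ih _ hlt (filter_subset _ _) hx' x ⟨hx.1, le_rfl⟩
      intro y hy
      by_contra! hy0
      have := hmin ⟨⟨hy.1, (hy.2.trans hx.2.le).trans hrt⟩, hy0⟩
      linarith [hy.2, hx.2]
    have hlink_r : 0 ≤ cliqueSum G {u ∈ U.erase v | G.Adj v u} r := by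
      have hcl : closure (Set.Ico 0 r) ⊆ {x | 0 ≤ cliqueSum G {u ∈ U.erase v | G.Adj v u} x} :=
        closure_minimal (fun x hx ↦ (hlink x hx).le)
          (isClosed_le continuous_const (continuous_cliqueSum G _))
      rw [closure_Ico hrpos.ne] at hcl
      exact hcl ⟨hr0, le_rfl⟩
    have hUr := hU r ⟨hr0, hrt⟩
    rw [← insert_erase hvU, cliqueSum_insert (notMem_erase v U)] at hUr
    nlinarith [mul_nonneg hr0 hlink_r]

end Induced

/-- The finite differences at `0` of the quadratic `(x - m) (x - (m + 1)) / 2`. -/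
lemma sum_powerset_alternating_quadratic {α : Type*} (L : Finset α) (m : ℝ) :
    ∑ K ∈ L.powerset, (-1 : ℝ) ^ (#L - #K) * ((#K - m) * (#K - (m + 1)) / 2)
      = if #L = 0 then m * (m + 1) / 2 else if #L = 1 then -m else if #L = 2 then 1 else 0 := by
  rw [sum_powerset_apply_card (fun k ↦ (-1 : ℝ) ^ (#L - k) * ((k - m) * (k - (m + 1)) / 2))]
  generalize #L = l
  match l with
  | 0 => simp; ring
  | 1 => simp [sum_range_succ]; ring
  | 2 => simp [sum_range_succ]; ring
  | l + 3 =>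
    let P : ℝ[X] := (X - C m) * (X - C (m + 1)) * C (1 / 2)
    have hP : P.natDegree < l + 3 := by
      have : P.natDegree ≤ 2 := by
        unfold P
        compute_degree
      omega
    have h := congrFun (Polynomial.fwdDiff_iter_eq_zero_of_degree_lt hP) 0
    rw [fwdDiff_iter_eq_sum_shift] at h
    simp only [Nat.add_eq_zero_iff, OfNat.ofNat_ne_zero, and_false, if_false,
      show l + 3 ≠ 1 by omega, show l + 3 ≠ 2 by omega]
    refine Eq.trans (sum_congr rfl fun k _ ↦ ?_) h
    simp [P]
    ring

section Finite

variable {V : Type*} [Fintype V] {G : SimpleGraph V}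

open Classical in
/-- The cliques containing a clique `K` correspond to the cliques in the common neighbourhood
of `K`. -/
lemma sum_cliques_superset {K : Finset V} (hK : G.IsClique (K : Set V)) (t : ℝ) :
    ∑ L ∈ cliquesIn G univ with K ⊆ L, (-1 : ℝ) ^ (#L - #K) * t ^ #L
      = t ^ #K * cliqueSum G {v | ∀ u ∈ K, G.Adj u v} t := by
  unfold cliqueSum
  rw [mul_sum]
  refine sum_bij' (fun L _ ↦ L \ K) (fun J _ ↦ K ∪ J) ?_ ?_ ?_ ?_ ?_
  · intro L hL
    simp only [mem_filter, mem_cliquesIn] at hL ⊢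
    refine ⟨fun v hv ↦ ?_, hL.1.2.subset (by simp)⟩
    rw [mem_sdiff] at hv
    simp only [mem_filter, mem_univ, true_and]
    exact fun u hu ↦ hL.1.2 (hL.2 hu) hv.1 (by rintro rfl; exact hv.2 hu)
  · intro J hJ
    simp only [mem_filter, mem_cliquesIn] at hJ ⊢
    refine ⟨⟨subset_univ _, ?_⟩, subset_union_left⟩
    have hJK : ∀ u ∈ K, ∀ v ∈ J, G.Adj u v := fun u hu v hv ↦ (mem_filter.1 (hJ.1 hv)).2 u hu
    intro a ha b hb hab
    rcases mem_union.1 ha with ha | ha <;> rcases mem_union.1 hb with hb | hb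
    · exact hK ha hb hab
    · exact hJK a ha b hb
    · exact (hJK b hb a ha).symm
    · exact hJ.2 ha hb hab
  · intro L hL
    exact union_sdiff_of_subset (mem_filter.1 hL).2
  · intro J hJ
    refine union_sdiff_cancel_left (disjoint_left.2 fun u hu hv ↦ ?_)
    exact G.irrefl ((mem_filter.1 ((mem_cliquesIn.1 hJ).1 hv)).2 u hu)
  · intro L hL
    have hle := card_le_card (mem_filter.1 hL).2
    rw [card_sdiff_of_subset (mem_filter.1 hL).2, neg_pow t, ← mul_assoc, mul_comm (t ^ #K),
      mul_assoc, ← pow_add, Nat.add_sub_cancel' hle]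

lemma sum_cliquesIn_card (g : ℕ → ℝ) {N : ℕ} (hN : cliqueNum G < N) :
    ∑ L ∈ cliquesIn G univ, g #L = ∑ k ∈ range N, (cliqueCount G k : ℝ) * g k := by
  classical
  have hbdd : BddAbove {k : ℕ | ∃ s : Finset V, G.IsNClique k s} :=
    ⟨Fintype.card V, by rintro k ⟨s, hs⟩; rw [← hs.card_eq]; exact card_le_univ s⟩
  have hmaps : ∀ L ∈ cliquesIn G univ, #L ∈ range N := fun L hL ↦
    mem_range.2 ((le_csSup hbdd ⟨L, (mem_cliquesIn.1 hL).2, rfl⟩).trans_lt hN)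
  rw [← sum_fiberwise_of_maps_to hmaps]
  refine sum_congr rfl fun k _ ↦ ?_
  rw [sum_congr rfl (g := fun _ ↦ g k) fun L hL ↦ by rw [(mem_filter.1 hL).2], sum_const,
    nsmul_eq_mul]
  congr 2
  rw [cliqueCount, Nat.card_eq_fintype_card, Fintype.card_subtype]
  congr 1
  ext L
  simp [mem_cliquesIn, SimpleGraph.isNClique_iff]

lemma cliqueCount_zero : cliqueCount G 0 = 1 := by
  rw [cliqueCount, Nat.card_eq_one_iff_exists]
  refine ⟨⟨∅, SimpleGraph.isNClique_zero.2 rfl⟩, fun s ↦ Subtype.ext ?_⟩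
  exact SimpleGraph.isNClique_zero.1 s.2

lemma cliqueCount_one : cliqueCount G 1 = Fintype.card V := by
  rw [← Nat.card_eq_fintype_card]
  refine (Nat.card_congr (Equiv.ofBijective
    (fun v ↦ (⟨{v}, SimpleGraph.isNClique_one.2 ⟨v, rfl⟩⟩ : {s // G.IsNClique 1 s})) ⟨?_, ?_⟩)).symm
  · intro u v huv
    simpa using huv
  · rintro ⟨s, hs⟩
    obtain ⟨v, rfl⟩ := SimpleGraph.isNClique_one.1 hs
    exact ⟨v, rfl⟩

lemma cliqueCount_two : cliqueCount G 2 = Nat.card G.edgeSet := by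
  classical
  have hmem (e : G.edgeSet) : G.IsNClique 2 (e : Sym2 V).toFinset := by
    obtain ⟨⟨u, v⟩, he⟩ := e
    have huv : G.Adj u v := he
    rw [SimpleGraph.isNClique_iff]
    simp [Sym2.toFinset_mk_eq, huv, huv.ne]
  refine (Nat.card_congr (Equiv.ofBijective
    (fun e : G.edgeSet ↦ (⟨(e : Sym2 V).toFinset, hmem e⟩ : {s // G.IsNClique 2 s})) ⟨?_, ?_⟩)).symm
  · intro e f hef
    refine Subtype.ext (Sym2.ext fun x ↦ ?_)
    have hef' : (e : Sym2 V).toFinset = (f : Sym2 V).toFinset := congrArg Subtype.val hef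
    rw [← Sym2.mem_toFinset, ← Sym2.mem_toFinset, hef']
  · rintro ⟨s, hs⟩
    obtain ⟨u, v, huv, rfl⟩ := card_eq_two.1 hs.card_eq
    have hadj : G.Adj u v := hs.isClique (by simp) (by simp) huv
    exact ⟨⟨s(u, v), hadj⟩, Subtype.ext (by simp [Sym2.toFinset_mk_eq])⟩

lemma eval_PCpoly {x : ℝ} (hx : x ≠ 0) :
    (PCpoly G).eval x = x ^ cliqueNum G * cliqueSum G univ x⁻¹ := by
  rw [cliqueSum, sum_cliquesIn_card (fun k ↦ (-x⁻¹) ^ k) (Nat.lt_succ_self _), PCpoly,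
    eval_finsetSum, mul_sum]
  refine sum_congr rfl fun k hk ↦ ?_
  have hk : k ≤ cliqueNum G := Nat.lt_succ_iff.1 (mem_range.1 hk)
  simp only [eval_mul, eval_C, eval_pow, eval_X]
  rw [← Nat.sub_add_cancel hk, Nat.add_sub_cancel, pow_add, neg_pow x⁻¹, inv_pow]
  field_simp

lemma PCpoly_ne_zero (G : SimpleGraph V) : PCpoly G ≠ 0 := by
  intro h
  obtain ⟨δ, hδ, hpos⟩ := Metric.continuousAt_iff.1
    (continuous_cliqueSum G univ).continuousAt (ε := 1) one_pos
  have hx : (2 / δ : ℝ) ≠ 0 := by positivity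
  have h0 := eval_PCpoly (G := G) hx
  rw [h, eval_zero, eq_comm, mul_eq_zero, or_iff_right (pow_ne_zero _ hx)] at h0
  have := @hpos (2 / δ)⁻¹ (by
    rw [Real.dist_eq, sub_zero, abs_of_pos (by positivity), inv_div]; linarith)
  rw [h0, cliqueSum_zero_right, Real.dist_eq] at this
  norm_num at this

/-- No root of the PC-polynomial exceeds `beta G`. -/
lemma le_beta_of_isRoot {x : ℝ} (hx : (PCpoly G).eval x = 0) : x ≤ beta G := by
  refine le_csSup (Set.Finite.bddAbove ?_) hx
  exact Polynomial.finite_setOfPred_isRoot (PCpoly_ne_zero G)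

/-- Before the first zero of the clique polynomial, the first three clique counts satisfy
a quadratic inequality for every natural number `m ≥ 1`. -/
lemma quadratic_pos_of_cliqueSum_pos {t : ℝ} (ht : 0 ≤ t)
    (hpos : ∀ s ∈ Set.Icc 0 t, 0 < cliqueSum G univ s) {m : ℕ} (hm : 1 ≤ m) :
    0 < (m : ℝ) * (m + 1) / 2 - m * Fintype.card V * t + Nat.card G.edgeSet * t ^ 2 := by
  classical
  have hmR : (1 : ℝ) ≤ m := by exact_mod_cast hm
  set h : ℕ → ℝ := fun k ↦ ((k : ℝ) - m) * (k - (m + 1)) / 2 with h_def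
  have hh (k : ℕ) : 0 ≤ h k := by
    have : (0 : ℤ) ≤ ((k : ℤ) - m) * (k - (m + 1)) := by
      rcases le_or_gt k m with hk | hk
      · exact mul_nonneg_of_nonpos_of_nonpos (by omega) (by omega)
      · exact mul_nonneg (by omega) (by omega)
    have : (0 : ℝ) ≤ ((k : ℝ) - m) * (k - (m + 1)) := by exact_mod_cast this
    simp only [h_def]
    linarith
  let p : Finset V → ℝ := fun K ↦ t ^ #K * cliqueSum G {v | ∀ u ∈ K, G.Adj u v} t
  have hp (K : Finset V) : 0 ≤ p K :=
    mul_nonneg (pow_nonneg ht _)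
      (cliqueSum_pos_of_subset (subset_univ _) hpos t ⟨ht, le_rfl⟩).le
  have hsum : 0 < ∑ K ∈ cliquesIn G univ, p K * h #K := by
    refine sum_pos' (fun K _ ↦ mul_nonneg (hp K) (hh _)) ⟨∅, by simp [mem_cliquesIn], ?_⟩
    refine mul_pos ?_ ?_
    · simpa [p] using hpos t ⟨ht, le_rfl⟩
    · simp only [h_def, card_empty, Nat.cast_zero]
      nlinarith
  have hswap : ∑ K ∈ cliquesIn G univ, p K * h #K
      = ∑ L ∈ cliquesIn G univ, t ^ #L * ∑ K ∈ L.powerset, (-1 : ℝ) ^ (#L - #K) * h #K := by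
    have hpK : ∀ K ∈ cliquesIn G univ, p K * h #K
        = ∑ L ∈ cliquesIn G univ with K ⊆ L, t ^ #L * ((-1 : ℝ) ^ (#L - #K) * h #K) := by
      intro K hK
      simp only [p]
      rw [← sum_cliques_superset (mem_cliquesIn.1 hK).2, sum_mul]
      exact sum_congr rfl fun L _ ↦ by ring
    simp only [mul_sum]
    rw [sum_congr rfl hpK]
    refine sum_comm' fun K L ↦ ?_
    simp only [mem_filter, mem_powerset, mem_cliquesIn, subset_univ, true_and]
    exact ⟨fun ⟨_, h2, h3⟩ ↦ ⟨h3, h2⟩, fun ⟨h3, h2⟩ ↦ ⟨h2.subset (by exact_mod_cast h3), h2, h3⟩⟩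
  rw [hswap] at hsum
  simp only [h_def, sum_powerset_alternating_quadratic] at hsum
  rw [sum_cliquesIn_card (fun k ↦ t ^ k * if k = 0 then (m : ℝ) * (m + 1) / 2 else
    if k = 1 then -m else if k = 2 then 1 else 0) (N := cliqueNum G + 1 + 3) (by omega),
    ← sum_subset (s₁ := range 3) (range_subset_range.2 (by omega))] at hsum
  · simp only [sum_range_succ, range_zero, sum_empty, cliqueCount_zero, cliqueCount_one,
      cliqueCount_two, if_true, one_ne_zero, OfNat.ofNat_ne_zero, OfNat.ofNat_ne_one, if_false,
      Nat.cast_one, pow_zero, pow_one] at hsum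
    linarith
  · intro k _ hk
    rw [mem_range, not_lt] at hk
    simp [show k ≠ 0 by omega, show k ≠ 1 by omega, show k ≠ 2 by omega]

lemma cliqueSum_pos_of_beta_lt {x : ℝ} (hβ : beta G < x) :
    ∀ s ∈ Set.Icc 0 x⁻¹, 0 < cliqueSum G univ s := by
  intro s hs
  by_contra! hneg
  obtain ⟨r, hr, hr0⟩ := intermediate_value_Icc' hs.1 (continuous_cliqueSum G univ).continuousOn
    ⟨hneg, by rw [cliqueSum_zero_right]; exact zero_le_one⟩
  have hrpos : 0 < r := by
    refine hr.1.lt_of_ne ?_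
    rintro rfl
    rw [cliqueSum_zero_right] at hr0
    exact one_ne_zero hr0
  have hle : r⁻¹ ≤ beta G := by
    apply le_beta_of_isRoot
    rw [eval_PCpoly (inv_ne_zero hrpos.ne'), inv_inv, hr0, mul_zero]
  have := inv_anti₀ hrpos (hr.2.trans hs.2)
  rw [inv_inv] at this
  linarith

end Finite

/-- If `(1 - 1/(w-1))·n²/2 < k ≤ (1 - 1/w)·n²/2` with `w ≥ 2`, then
`β(G) ≥ (n/w)·(1 + √(1 - 2kw/(n²(w-1))))`. -/
theorem stmt_12 {V : Type*} [Fintype V] (G : SimpleGraph V) (w : ℕ) (hw : 2 ≤ w)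
    (h1 : (1 - 1 / ((w : ℝ) - 1)) * (Fintype.card V : ℝ) ^ 2 / 2
        < (Nat.card G.edgeSet : ℝ))
    (h2 : (Nat.card G.edgeSet : ℝ)
        ≤ (1 - 1 / (w : ℝ)) * (Fintype.card V : ℝ) ^ 2 / 2) :
    ((Fintype.card V : ℝ) / (w : ℝ)) *
        (1 + Real.sqrt (1 - 2 * (Nat.card G.edgeSet : ℝ) * (w : ℝ) /
          ((Fintype.card V : ℝ) ^ 2 * ((w : ℝ) - 1))))
      ≤ beta G := by
  obtain ⟨m, rfl⟩ : ∃ m, w = m + 1 := ⟨w - 1, by omega⟩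
  have hm : 1 ≤ m := by omega
  have hmR : (0 : ℝ) < m := by exact_mod_cast hm
  have hn : (0 : ℝ) < Fintype.card V := by
    rcases (Nat.cast_nonneg (α := ℝ) (Fintype.card V)).eq_or_lt with h0 | h0
    · exfalso
      rw [← h0] at h1 h2
      simp only [ne_eq, OfNat.ofNat_ne_zero, not_false_eq_true, zero_pow, mul_zero, zero_div]
        at h1 h2
      linarith
    · exact h0
  push_cast at h2 ⊢
  rw [add_sub_cancel_right]
  set n : ℝ := (Fintype.card V : ℝ) with n_def
  set k : ℝ := (Nat.card G.edgeSet : ℝ) with k_def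
  set D : ℝ := 1 - 2 * k * (m + 1) / (n ^ 2 * m) with hD
  have hD0 : 0 ≤ D := by
    rw [hD, sub_nonneg, div_le_one (by positivity)]
    have h3 : (1 - 1 / ((m : ℝ) + 1)) * n ^ 2 / 2 * (2 * (m + 1)) = n ^ 2 * m := by
      field_simp
      ring
    nlinarith
  obtain ⟨r, hr0, hr⟩ : ∃ r, 0 ≤ r ∧ √D = r := ⟨_, Real.sqrt_nonneg _, rfl⟩
  have hk : k = (1 - r ^ 2) * (n ^ 2 * m) / (2 * (m + 1)) := by
    rw [← hr, Real.sq_sqrt hD0, hD]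
    field_simp
    ring
  rw [hr]
  set x : ℝ := n / (m + 1) * (1 + r) with x_def
  have hx : 0 < x := by positivity
  by_contra! hβ
  have hpos := quadratic_pos_of_cliqueSum_pos (inv_nonneg.2 hx.le)
    (cliqueSum_pos_of_beta_lt hβ) hm
  rw [← n_def, ← k_def] at hpos
  refine hpos.ne' ?_
  rw [hk, x_def]
  field_simp
  ring
end
end

section
/- Let G be a finite simple graph with n ≥ 1 vertices and let Ḡ denote its complement. Then β(G) + β(Ḡ) ≥ n + 1 and β(G)·β(Ḡ) ≥ n. In each of the two inequalities, equality holds if and only if G is the complete graph on n vertices or the edgeless graph on n vertices. -/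
noncomputable section

open scoped Classical in
/-- The dependence polynomial `∑ (-t)^|s|`, summed over the cliques `s` of `G` contained in `W`. -/
def dependenceSum {V : Type*} (G : SimpleGraph V) (W : Finset V) (t : ℝ) : ℝ :=
  ∑ s ∈ W.powerset.filter fun s : Finset V => G.IsClique (s : Set V), (-t) ^ s.card

section Dependence

open Finset
open scoped Classical

variable {V : Type*} {G : SimpleGraph V}

/-- If adjacency and non-adjacency are both transitive on distinct vertices, the graph is complete
or edgeless. -/
lemma eq_top_or_eq_bot
    (h1 : ∀ u v w, u ≠ v → w ≠ v → G.Adj u w → G.Adj v u ∨ G.Adj v w)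
    (h2 : ∀ u v w, u ≠ w → G.Adj v u → G.Adj v w → G.Adj u w) : G = ⊤ ∨ G = ⊥ := by
  by_contra! hcon
  obtain ⟨a, b, hab⟩ := SimpleGraph.ne_bot_iff_exists_adj.1 hcon.2
  have ha : ∀ c, c ≠ a → G.Adj a c := by
    intro c hca
    by_cases hcb : c = b
    · exact hcb ▸ hab
    · rcases h1 a c b (Ne.symm hca) (Ne.symm hcb) hab with h | h
      · exact h.symm
      · exact h2 a b c (Ne.symm hca) hab.symm h.symm
  refine hcon.1 (SimpleGraph.ext ?_)
  ext c d
  refine ⟨fun h => h.ne, fun hcd => ?_⟩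
  have hcd : c ≠ d := hcd
  by_cases hc : c = a
  · exact hc ▸ ha d fun hd => hcd (hc.trans hd.symm)
  · by_cases hd : d = a
    · exact hd ▸ (ha c hc).symm
    · exact h2 c a d hcd (ha c hc) (ha d hd)

lemma dependenceSum_empty (t : ℝ) : dependenceSum G ∅ t = 1 := by
  simp [dependenceSum, Finset.filter_singleton]

lemma dependenceSum_insert {v : V} {W : Finset V} (hv : v ∉ W) (t : ℝ) :
    dependenceSum G (insert v W) t =
      dependenceSum G W t - t * dependenceSum G (W.filter (G.Adj v)) t := by
  have h : W.powerset.filter (fun s : Finset V => G.IsClique ((insert v s : Finset V) : Set V)) =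
      (W.filter (G.Adj v)).powerset.filter fun s : Finset V => G.IsClique (s : Set V) := by
    ext s
    simp only [mem_filter, mem_powerset, coe_insert, SimpleGraph.isClique_insert, subset_iff,
      mem_coe]
    constructor
    · rintro ⟨hs, hc, ha⟩
      exact ⟨fun x hx => ⟨hs hx, ha x hx fun h => hv (h ▸ hs hx)⟩, hc⟩
    · rintro ⟨hs, hc⟩
      exact ⟨fun x hx => (hs hx).1, hc, fun x hx _ => (hs hx).2⟩
  unfold dependenceSum
  rw [sum_filter, sum_powerset_insert hv, ← sum_filter, ← sum_filter, h, sub_eq_add_neg,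
    ← neg_mul, mul_sum]
  congr 1
  refine sum_congr rfl fun s hs => ?_
  rw [card_insert_of_notMem, pow_succ']
  simp only [mem_filter, mem_powerset] at hs
  exact fun h => hv (mem_filter.1 (hs.1 h)).1

lemma continuous_dependenceSum (W : Finset V) : Continuous (dependenceSum G W) := by
  unfold dependenceSum; fun_prop

lemma dependenceSum_zero (W : Finset V) : dependenceSum G W 0 = 1 := by
  induction W using Finset.induction_on with
  | empty => exact dependenceSum_empty 0
  | insert v W hv ih => rw [dependenceSum_insert hv, ih]; simp

lemma dependenceSum_top (W : Finset V) (t : ℝ) :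
    dependenceSum (⊤ : SimpleGraph V) W t = (1 - t) ^ W.card := by
  obtain ⟨H, hH⟩ : ∃ H : SimpleGraph V, H = ⊤ := ⟨_, rfl⟩
  rw [← hH]
  induction W using Finset.induction_on with
  | empty => simp [dependenceSum_empty]
  | insert v W hv ih =>
    rw [dependenceSum_insert hv, filter_true_of_mem, ih, card_insert_of_notMem hv]
    · ring
    · intro x hx
      rw [hH, SimpleGraph.top_adj]
      exact fun h => hv (h ▸ hx)

lemma dependenceSum_bot (W : Finset V) (t : ℝ) :
    dependenceSum (⊥ : SimpleGraph V) W t = 1 - W.card * t := by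
  induction W using Finset.induction_on with
  | empty => simp [dependenceSum_empty]
  | insert v W hv ih =>
    rw [dependenceSum_insert hv, ih, card_insert_of_notMem hv]
    simp [dependenceSum_empty]
    ring

lemma dependenceSum_anti {t : ℝ} (ht : 0 ≤ t) (h : ∀ W, 0 ≤ dependenceSum G W t)
    {W W' : Finset V} (hW : W ⊆ W') : dependenceSum G W' t ≤ dependenceSum G W t := by
  suffices ∀ U : Finset V, dependenceSum G (U ∪ W) t ≤ dependenceSum G W t by
    simpa [union_eq_left.2 hW] using this W'
  intro U
  induction U using Finset.induction_on with
  | empty => simp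
  | insert v U hv ih =>
    rw [insert_union]
    by_cases hvW : v ∈ U ∪ W
    · rwa [insert_eq_of_mem hvW]
    · rw [dependenceSum_insert hvW]
      linarith [mul_nonneg ht (h ((U ∪ W).filter (G.Adj v)))]

variable [Fintype V]

/-- The dependence sum of the neighbourhood of `v`. -/
def nbrSum (G : SimpleGraph V) (t : ℝ) (v : V) : ℝ :=
  dependenceSum G (univ.filter (G.Adj v)) t

lemma dependenceSum_union_le {t : ℝ} (ht : 0 ≤ t) (h : ∀ W, 0 ≤ dependenceSum G W t)
    (W U : Finset V) (hWU : Disjoint U W) :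
    dependenceSum G (U ∪ W) t ≤ dependenceSum G W t - t * ∑ x ∈ U, nbrSum G t x := by
  induction U using Finset.induction_on with
  | empty => simp
  | insert v U hv ih =>
    rw [disjoint_insert_left] at hWU
    rw [insert_union, dependenceSum_insert (by simp [hv, hWU.1]), sum_insert hv]
    have h1 : nbrSum G t v ≤ dependenceSum G ((U ∪ W).filter (G.Adj v)) t :=
      dependenceSum_anti ht h (filter_subset_filter _ (subset_univ _))
    linarith [ih hWU.2, mul_le_mul_of_nonneg_left h1 ht]

lemma mul_sum_nbrSum_le {t : ℝ} (ht : 0 ≤ t) (h : ∀ W, 0 ≤ dependenceSum G W t) (v : V) :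
    t * ∑ x with ¬ G.Adj v x, nbrSum G t x ≤ nbrSum G t v := by
  have := dependenceSum_union_le ht h (univ.filter (G.Adj v)) (univ.filter fun x => ¬ G.Adj v x)
    (disjoint_filter_filter_not _ _ _).symm
  have h1 := h ((univ.filter fun x => ¬ G.Adj v x) ∪ univ.filter (G.Adj v))
  unfold nbrSum at *
  linarith

lemma mul_sum_nbrSum_add_le {t : ℝ} (ht : 0 ≤ t) (h : ∀ W, 0 ≤ dependenceSum G W t) {u v w : V}
    (hvu : ¬ G.Adj v u) (hvw : ¬ G.Adj v w) (huw : G.Adj u w) :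
    t * ∑ x with ¬ G.Adj v x, nbrSum G t x + t * (t * nbrSum G t u) ≤ nbrSum G t v := by
  set N := univ.filter (G.Adj v)
  set C := univ.filter fun x => ¬ G.Adj v x
  have hwN : w ∉ N := by simp [N, hvw]
  have hwC : w ∈ C := by simp [C, hvw]
  have hdis : Disjoint (C.erase w) (insert w N) := by
    rw [disjoint_left]
    intro x hx
    simp only [mem_erase, C, N, mem_filter, mem_insert, mem_univ, true_and] at hx ⊢
    tauto
  have h1 := dependenceSum_union_le ht h (insert w N) (C.erase w) hdis
  rw [dependenceSum_insert hwN] at h1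
  have h2 := add_sum_erase C (nbrSum G t) hwC
  have h3 : dependenceSum G ((univ.filter (G.Adj w)).erase u) t ≤
      dependenceSum G (N.filter (G.Adj w)) t := by
    refine dependenceSum_anti ht h fun x hx => ?_
    simp only [N, mem_filter, mem_univ, true_and, mem_erase] at hx ⊢
    exact ⟨fun hxu => hvu (hxu ▸ hx.1), hx.2⟩
  have h4 : nbrSum G t w = dependenceSum G ((univ.filter (G.Adj w)).erase u) t -
      t * dependenceSum G (((univ.filter (G.Adj w)).erase u).filter (G.Adj u)) t := by
    rw [← dependenceSum_insert (notMem_erase _ _), insert_erase (by simp [huw.symm])]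
    rfl
  have h5 : nbrSum G t u ≤
      dependenceSum G (((univ.filter (G.Adj w)).erase u).filter (G.Adj u)) t :=
    dependenceSum_anti ht h (filter_subset_filter _ (subset_univ _))
  have h6 := h (C.erase w ∪ insert w N)
  have h7 : nbrSum G t w + t * nbrSum G t u ≤ dependenceSum G (N.filter (G.Adj w)) t := by
    linarith [mul_le_mul_of_nonneg_left h5 ht]
  have h8 := mul_le_mul_of_nonneg_left h7 ht
  have h9 : nbrSum G t v = dependenceSum G N t := rfl
  rw [← h2]
  linarith

/-- The number of ordered pairs of non-adjacent (possibly equal) vertices. -/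
def nonadjCount (G : SimpleGraph V) : ℝ :=
  ∑ v : V, ∑ u : V, if G.Adj v u then 0 else 1

lemma nonadjCount_add_compl (G : SimpleGraph V) :
    nonadjCount G + nonadjCount Gᶜ = Fintype.card V * (Fintype.card V + 1) := by
  obtain ⟨H, hH⟩ : ∃ H, H = Gᶜ := ⟨_, rfl⟩
  rw [← hH]
  have h : ∀ v u : V, ((if G.Adj v u then 0 else 1) + (if H.Adj v u then 0 else 1) : ℝ) =
      1 + if v = u then 1 else 0 := by
    intro v u
    have hadj : H.Adj v u ↔ v ≠ u ∧ ¬ G.Adj v u := by rw [hH, SimpleGraph.compl_adj]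
    by_cases h1 : v = u
    · subst h1; norm_num [hadj]
    · by_cases h2 : G.Adj v u <;> simp [hadj, h1, h2]
  unfold nonadjCount
  rw [← sum_add_distrib]
  simp_rw [← sum_add_distrib, h]
  simp [sum_add_distrib]
  ring

lemma card_le_nonadjCount (G : SimpleGraph V) : (Fintype.card V : ℝ) ≤ nonadjCount G := by
  have h : ∀ v : V, (1 : ℝ) ≤ ∑ u : V, if G.Adj v u then 0 else 1 := fun v => by
    refine le_trans (by simp) (single_le_sum (f := fun u => if G.Adj v u then (0 : ℝ) else 1)
      (fun u _ => by positivity) (mem_univ v))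
  simpa [nonadjCount] using sum_le_sum fun v (_ : v ∈ univ) => h v

lemma two_le_div_add_div {x y : ℝ} (hx : 0 < x) (hy : 0 < y) : 2 ≤ x / y + y / x := by
  rw [div_add_div _ _ hy.ne' hx.ne', le_div_iff₀ (by positivity)]
  nlinarith [sq_nonneg (x - y)]

/-- The sum of the ratios `z u / z v` over non-adjacent pairs. -/
def ratioSum (G : SimpleGraph V) (z : V → ℝ) : ℝ :=
  ∑ v : V, ∑ u : V, if G.Adj v u then 0 else z u / z v

lemma ratioSum_eq (G : SimpleGraph V) (z : V → ℝ) :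
    2 * (ratioSum G z - nonadjCount G) =
      ∑ v : V, ∑ u : V, if G.Adj v u then 0 else z u / z v + z v / z u - 2 := by
  have h : ratioSum G z = ∑ v : V, ∑ u : V, if G.Adj v u then 0 else z v / z u := by
    unfold ratioSum
    rw [sum_comm]
    simp_rw [G.adj_comm]
  rw [two_mul, ← add_sub_right_comm]
  nth_rw 2 [h]
  rw [add_sub_assoc', sub_sub, ← two_mul]
  unfold ratioSum nonadjCount
  simp_rw [mul_sum, ← sum_add_distrib, ← sum_sub_distrib]
  refine sum_congr rfl fun v _ => sum_congr rfl fun u _ => ?_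
  split_ifs <;> ring

lemma nonadjCount_le_ratioSum {z : V → ℝ} (hz : ∀ v, 0 < z v) :
    nonadjCount G ≤ ratioSum G z := by
  have h : 0 ≤ 2 * (ratioSum G z - nonadjCount G) := by
    rw [ratioSum_eq]
    refine sum_nonneg fun v _ => sum_nonneg fun u _ => ?_
    split_ifs
    · rfl
    · linarith [two_le_div_add_div (hz u) (hz v)]
  linarith

lemma nonadjCount_add_le_ratioSum {z : V → ℝ} (hz : ∀ v, 0 < z v) {u v : V}
    (huv : ¬ G.Adj v u) (hne : u ≠ v) :
    nonadjCount G + (z u / z v + z v / z u - 2) ≤ ratioSum G z := by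
  set f : V → V → ℝ := fun v u => if G.Adj v u then 0 else z u / z v + z v / z u - 2
  have hf : ∀ v u, 0 ≤ f v u := fun v u => by
    simp only [f]
    split_ifs
    · rfl
    · linarith [two_le_div_add_div (hz u) (hz v)]
  have h : f v u + f u v ≤ 2 * (ratioSum G z - nonadjCount G) := by
    rw [ratioSum_eq]
    calc f v u + f u v ≤ ∑ y, f v y + ∑ y, f u y :=
          add_le_add (single_le_sum (fun y _ => hf v y) (mem_univ u))
            (single_le_sum (fun y _ => hf u y) (mem_univ v))
      _ = ∑ x ∈ {v, u}, ∑ y, f x y := (sum_pair (f := fun x => ∑ y, f x y) hne.symm).symm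
      _ ≤ ∑ x, ∑ y, f x y :=
          sum_le_sum_of_subset_of_nonneg (subset_univ _)
            fun x _ _ => sum_nonneg fun y _ => hf x y
  simp only [f, huv, G.adj_comm u v, if_false] at h
  linarith

lemma mul_nonadjCount_le {t : ℝ} (ht : 0 ≤ t) (h : ∀ W, 0 < dependenceSum G W t) :
    t * nonadjCount G ≤ Fintype.card V := by
  have hz : ∀ v, 0 < nbrSum G t v := fun v => h _
  calc t * nonadjCount G ≤ t * ratioSum G (nbrSum G t) :=
        mul_le_mul_of_nonneg_left (nonadjCount_le_ratioSum hz) ht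
    _ = ∑ v : V, (t * ∑ x with ¬ G.Adj v x, nbrSum G t x) / nbrSum G t v := by
        simp_rw [ratioSum, mul_sum, sum_filter, sum_div]
        refine sum_congr rfl fun v _ => sum_congr rfl fun u _ => ?_
        split_ifs <;> simp_all [mul_div_assoc]
    _ ≤ ∑ v : V, (1 : ℝ) := sum_le_sum fun v _ =>
        (div_le_one (hz v)).2 (mul_sum_nbrSum_le ht (fun W => (h W).le) v)
    _ = Fintype.card V := by simp

lemma mul_nonadjCount_add_le {t : ℝ} (ht : 0 ≤ t) (ht1 : t ≤ 1)
    (h : ∀ W, 0 < dependenceSum G W t) {u v w : V} (hne : u ≠ v)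
    (hvu : ¬ G.Adj v u) (hvw : ¬ G.Adj v w) (huw : G.Adj u w) :
    t * (nonadjCount G + t / 2) ≤ Fintype.card V := by
  have hz : ∀ v, 0 < nbrSum G t v := fun v => h _
  set z := nbrSum G t
  have hq : 0 < z u / z v := div_pos (hz u) (hz v)
  have hdef : t / 2 ≤ (z u / z v + z v / z u - 2) + t * (z u / z v) := by
    rw [← inv_div (z u) (z v)]
    set q := z u / z v
    have h1 : 0 ≤ q⁻¹ * (1 - (1 + t / 4) * q) ^ 2 := by positivity
    have h2 : q⁻¹ * (1 - (1 + t / 4) * q) ^ 2 =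
        q⁻¹ - 2 * (1 + t / 4) + (1 + t / 4) ^ 2 * q := by field_simp; ring
    have h3 : 0 ≤ q * (t * (8 - t)) := by
      have : 0 ≤ 8 - t := by linarith
      positivity
    nlinarith
  calc t * (nonadjCount G + t / 2) ≤ t * (ratioSum G z + t * (z u / z v)) :=
        mul_le_mul_of_nonneg_left
          (by linarith [nonadjCount_add_le_ratioSum hz hvu hne]) ht
    _ = ∑ x : V, (t * ∑ y with ¬ G.Adj x y, z y + if x = v then t * (t * z u) else 0) / z x := by
        simp_rw [add_div, sum_add_distrib, ite_div, zero_div]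
        rw [sum_ite_eq' univ v, if_pos (mem_univ v), mul_add]
        congr 1
        · simp_rw [ratioSum, mul_sum, sum_filter, sum_div]
          refine sum_congr rfl fun v _ => sum_congr rfl fun u _ => ?_
          split_ifs <;> simp_all [mul_div_assoc]
        · ring
    _ ≤ ∑ v : V, (1 : ℝ) := sum_le_sum fun x _ => by
        rw [div_le_one (hz x)]
        split_ifs with hx
        · subst hx
          exact mul_sum_nbrSum_add_le ht (fun W => (h W).le) hvu hvw huw
        · rw [add_zero]
          exact mul_sum_nbrSum_le ht (fun W => (h W).le) x
    _ = Fintype.card V := by simp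

/-- The dependence polynomial has a smallest positive root, up to which the dependence sums of all
vertex subsets are positive. -/
lemma exists_first_root [Nonempty V] (G : SimpleGraph V) :
    ∃ r > 0, dependenceSum G univ r = 0 ∧
      ∀ t, 0 ≤ t → t < r → ∀ W, 0 < dependenceSum G W t := by
  set S : Set ℝ := Set.Icc 0 2 ∩ ⋃ W : Finset V, {t | dependenceSum G W t ≤ 0}
  have hS : IsCompact S := isCompact_Icc.inter_right <| isClosed_iUnion_of_finite fun W =>
    isClosed_le (continuous_dependenceSum W) continuous_const
  have hne : S.Nonempty := by
    by_contra hcon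
    have hpos : ∀ W, 0 < dependenceSum G W 2 := fun W => by
      by_contra! hW
      exact hcon ⟨2, by norm_num, Set.mem_iUnion.2 ⟨W, hW⟩⟩
    have h1 := mul_nonadjCount_le (by norm_num) hpos
    have h2 := card_le_nonadjCount G
    have h3 : (0 : ℝ) < Fintype.card V := by exact_mod_cast Fintype.card_pos
    linarith
  obtain ⟨r, hrS, hmin⟩ := hS.exists_isLeast hne
  obtain ⟨⟨hr0, hr2⟩, hrU⟩ := hrS
  obtain ⟨W, hW⟩ := Set.mem_iUnion.1 hrU
  have hr : 0 < r := by
    refine lt_of_le_of_ne hr0 fun h0 => ?_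
    have hW' : dependenceSum G W r ≤ 0 := hW
    rw [← h0, dependenceSum_zero] at hW'
    linarith
  have hlt : ∀ t, 0 ≤ t → t < r → ∀ W, 0 < dependenceSum G W t := fun t ht htr W => by
    by_contra! hcon
    exact htr.not_ge (hmin ⟨⟨ht, htr.le.trans hr2⟩, Set.mem_iUnion.2 ⟨W, hcon⟩⟩)
  have hle : ∀ W, 0 ≤ dependenceSum G W r := fun W => by
    have hc : IsClosed {t | 0 ≤ dependenceSum G W t} :=
      isClosed_le continuous_const (continuous_dependenceSum W)
    have hsub : Set.Ioo 0 r ⊆ {t | 0 ≤ dependenceSum G W t} := fun t ht =>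
      (hlt t ht.1.le ht.2 W).le
    have hcl := hc.closure_subset_iff.2 hsub
    rw [closure_Ioo hr.ne] at hcl
    exact hcl ⟨hr0, le_rfl⟩
  exact ⟨r, hr, le_antisymm ((dependenceSum_anti hr0 hle (subset_univ W)).trans hW) (hle _), hlt⟩

lemma card_le_cliqueNum {s : Finset V} (hs : G.IsClique (s : Set V)) :
    s.card ≤ cliqueNum G := by
  refine le_csSup ⟨Fintype.card V, ?_⟩ ⟨s, hs, rfl⟩
  rintro k ⟨s, hs⟩
  exact hs.card_eq ▸ s.card_le_univ

lemma PCpoly_eval (G : SimpleGraph V) {t : ℝ} (ht : t ≠ 0) :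
    (PCpoly G).eval t⁻¹ = t⁻¹ ^ cliqueNum G * dependenceSum G univ t := by
  have h : dependenceSum G univ t =
      ∑ k ∈ range (cliqueNum G + 1), (cliqueCount G k : ℝ) * (-t) ^ k := by
    unfold dependenceSum
    rw [← sum_fiberwise_of_maps_to (g := Finset.card) (t := range (cliqueNum G + 1))
      (f := fun s : Finset V => (-t) ^ s.card) fun s hs => mem_range.2 (Nat.lt_succ_of_le (card_le_cliqueNum (mem_filter.1 hs).2))]
    refine sum_congr rfl fun k _ => ?_
    rw [sum_congr rfl fun s hs => by rw [(mem_filter.1 hs).2], sum_const, nsmul_eq_mul]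
    congr 2
    rw [cliqueCount, Nat.card_eq_fintype_card, Fintype.card_subtype, filter_filter]
    simp [SimpleGraph.isNClique_iff]
  rw [h, PCpoly, Polynomial.eval_finsetSum, mul_sum]
  refine sum_congr rfl fun k hk => ?_
  have hk' : k ≤ cliqueNum G := Nat.lt_succ_iff.1 (mem_range.1 hk)
  simp only [Polynomial.eval_mul, Polynomial.eval_C, Polynomial.eval_pow, Polynomial.eval_X]
  rw [← Nat.sub_add_cancel hk', pow_add, Nat.add_sub_cancel, neg_pow t k]
  have : t⁻¹ ^ k * t ^ k = 1 := by rw [← mul_pow, inv_mul_cancel₀ ht, one_pow]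
  linear_combination (-(-1) ^ k * (cliqueCount G k : ℝ) * t⁻¹ ^ (cliqueNum G - k)) * this

lemma beta_eq_inv {r : ℝ} (hr : 0 < r) (h0 : dependenceSum G univ r = 0)
    (h : ∀ t, 0 < t → t < r → dependenceSum G univ t ≠ 0) : beta G = r⁻¹ := by
  refine IsGreatest.csSup_eq ⟨?_, fun x hx => ?_⟩
  · simp [PCpoly_eval G hr.ne', h0]
  · by_contra! hlt
    have hx0 : 0 < x := (inv_pos.2 hr).trans hlt
    have hx' : (PCpoly G).eval x⁻¹⁻¹ = 0 := by rwa [inv_inv]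
    rw [PCpoly_eval G (inv_pos.2 hx0).ne'] at hx'
    exact h x⁻¹ (inv_pos.2 hx0) (inv_lt_of_inv_lt₀ hr hlt) (by simpa [hx0.ne'] using hx')

variable [Nonempty V]

lemma beta_top : beta (⊤ : SimpleGraph V) = 1 := by
  rw [beta_eq_inv one_pos, inv_one]
  · simp [dependenceSum_top]
  · intro t _ ht
    rw [dependenceSum_top]
    exact pow_ne_zero _ (by linarith)

lemma beta_bot : beta (⊥ : SimpleGraph V) = Fintype.card V := by
  have h3 : (0 : ℝ) < Fintype.card V := by exact_mod_cast Fintype.card_pos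
  rw [beta_eq_inv (inv_pos.2 h3), inv_inv]
  · simp [dependenceSum_bot]
  · intro t _ ht
    rw [dependenceSum_bot, card_univ]
    have := mul_lt_mul_of_pos_left ht h3
    rw [mul_inv_cancel₀ h3.ne'] at this
    linarith

lemma nonadjCount_le_card_mul_beta (G : SimpleGraph V) :
    nonadjCount G ≤ Fintype.card V * beta G := by
  obtain ⟨r, hr, h0, hpos⟩ := exists_first_root G
  rw [beta_eq_inv hr h0 fun t ht htr => (hpos t ht.le htr _).ne', ← div_eq_mul_inv,
    le_div_iff₀' hr]
  have hc : IsClosed {t : ℝ | t * nonadjCount G ≤ Fintype.card V} :=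
    isClosed_le (by fun_prop) continuous_const
  have hcl := hc.closure_subset_iff.2 fun t (ht : t ∈ Set.Ioo 0 r) =>
    mul_nonadjCount_le ht.1.le (hpos t ht.1.le ht.2)
  rw [closure_Ioo hr.ne] at hcl
  exact hcl ⟨hr.le, le_rfl⟩

lemma one_le_beta (G : SimpleGraph V) : 1 ≤ beta G := by
  have h3 : (0 : ℝ) < Fintype.card V := by exact_mod_cast Fintype.card_pos
  have := (card_le_nonadjCount G).trans (nonadjCount_le_card_mul_beta G)
  exact le_of_mul_le_mul_left (by rwa [mul_one]) h3

lemma nonadjCount_lt_card_mul_beta {u v w : V} (hne : u ≠ v)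
    (hvu : ¬ G.Adj v u) (hvw : ¬ G.Adj v w) (huw : G.Adj u w) :
    nonadjCount G < Fintype.card V * beta G := by
  have hb := one_le_beta G
  obtain ⟨r, hr, h0, hpos⟩ := exists_first_root G
  rw [beta_eq_inv hr h0 fun t ht htr => (hpos t ht.le htr _).ne'] at hb ⊢
  have hr1 : r ≤ 1 := (one_le_inv₀ hr).1 hb
  rw [← div_eq_mul_inv, lt_div_iff₀' hr]
  have hc : IsClosed {t : ℝ | t * (nonadjCount G + t / 2) ≤ Fintype.card V} :=
    isClosed_le (by fun_prop) continuous_const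
  have hcl := hc.closure_subset_iff.2 fun t (ht : t ∈ Set.Ioo 0 r) =>
    mul_nonadjCount_add_le ht.1.le (ht.2.le.trans hr1) (hpos t ht.1.le ht.2) hne hvu hvw huw
  rw [closure_Ioo hr.ne] at hcl
  have hlim : r * (nonadjCount G + r / 2) ≤ Fintype.card V := hcl ⟨hr.le, le_rfl⟩
  nlinarith

lemma card_add_one_le_beta_add (G : SimpleGraph V) :
    (Fintype.card V : ℝ) + 1 ≤ beta G + beta Gᶜ := by
  have h3 : (0 : ℝ) < Fintype.card V := by exact_mod_cast Fintype.card_pos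
  refine le_of_mul_le_mul_left ?_ h3
  linarith [nonadjCount_add_compl G, nonadjCount_le_card_mul_beta G,
    nonadjCount_le_card_mul_beta Gᶜ]

lemma card_add_one_lt_beta_add {u v w : V} (hne : u ≠ v)
    (hvu : ¬ G.Adj v u) (hvw : ¬ G.Adj v w) (huw : G.Adj u w) :
    (Fintype.card V : ℝ) + 1 < beta G + beta Gᶜ := by
  have h3 : (0 : ℝ) < Fintype.card V := by exact_mod_cast Fintype.card_pos
  refine lt_of_mul_lt_mul_left ?_ h3.le
  linarith [nonadjCount_add_compl G, nonadjCount_lt_card_mul_beta hne hvu hvw huw,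
    nonadjCount_le_card_mul_beta Gᶜ]

lemma eq_top_or_eq_bot_of_beta_add_eq (h : beta G + beta Gᶜ = (Fintype.card V : ℝ) + 1) :
    G = ⊤ ∨ G = ⊥ := by
  refine eq_top_or_eq_bot (fun u v w huv _ huw => ?_) fun u v w huw hvu hvw => ?_
  · by_contra! hcon
    exact h.not_gt (card_add_one_lt_beta_add huv hcon.1 hcon.2 huw)
  · by_contra hcon
    have := card_add_one_lt_beta_add (G := Gᶜ) hvu.ne' (fun h => (G.compl_adj _ _ |>.1 h).2 hvu)
      (fun h => (G.compl_adj _ _ |>.1 h).2 hvw) ((G.compl_adj _ _).2 ⟨huw, hcon⟩)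
    rw [compl_compl, add_comm (beta Gᶜ)] at this
    exact h.not_gt this

end Dependence

/-- Nordhaus–Gaddum type lower bounds: `β(G) + β(Ḡ) ≥ n + 1` and `β(G)·β(Ḡ) ≥ n`,
with equality (in either) iff `G` is complete or edgeless. -/
theorem stmt_13 {V : Type*} [Fintype V] [Nonempty V] (G : SimpleGraph V) :
    ((Fintype.card V : ℝ) + 1 ≤ beta G + beta Gᶜ) ∧
    ((Fintype.card V : ℝ) ≤ beta G * beta Gᶜ) ∧
    (beta G + beta Gᶜ = (Fintype.card V : ℝ) + 1 ↔ G = ⊤ ∨ G = ⊥) ∧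
    (beta G * beta Gᶜ = (Fintype.card V : ℝ) ↔ G = ⊤ ∨ G = ⊥) := by
  have hadd := card_add_one_le_beta_add G
  have hmul : 0 ≤ (beta G - 1) * (beta Gᶜ - 1) :=
    mul_nonneg (sub_nonneg.2 (one_le_beta G)) (sub_nonneg.2 (one_le_beta Gᶜ))
  refine ⟨hadd, by linarith, ⟨eq_top_or_eq_bot_of_beta_add_eq, ?_⟩,
    ⟨fun h => eq_top_or_eq_bot_of_beta_add_eq (by linarith), ?_⟩⟩
  · rintro (rfl | rfl)
    · rw [compl_top, beta_top, beta_bot, add_comm]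
    · rw [compl_bot, beta_top, beta_bot]
  · rintro (rfl | rfl)
    · rw [compl_top, beta_top, beta_bot, one_mul]
    · rw [compl_bot, beta_top, beta_bot, mul_one]
end
end
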